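/- arXiv:2012.07032 — 8 statements merged into one kernel-verified Lean document; each statement's English description precedes it below -/
import Mathlib

section
/- Let n ≥ 1 and let G be an invertible n×n real matrix whose rows g₁,…,gₙ satisfy G·Gᵀ = Jₙ + Iₙ, where Jₙ is the all-ones matrix and Iₙ the identity (so the rows form a basis of the root lattice Aₙ consisting of minimal vectors with pairwise inner product 1). Then this basis is Voronoi-reduced: for every point y = αG with α ∈ [0,1)ⁿ there exists ẑ ∈ {0,1}ⁿ such that ‖y − ẑG‖ ≤ ‖y − zG‖ for every z ∈ ℤⁿ. -/
open Matrix

/-- Euclidean norm of a vector in `ℝⁿ`. -/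
noncomputable def nrm {n : ℕ} (v : Fin n → ℝ) : ℝ := Real.sqrt (∑ i, v i ^ 2)

/-- The quadratic form with Gram matrix `J + I`. -/
def rootForm {n : ℕ} (x : Fin n → ℝ) : ℝ := (∑ i, x i) ^ 2 + ∑ i, x i ^ 2

lemma rootForm_add_single {n : ℕ} (x : Fin n → ℝ) (i : Fin n) (c : ℝ) :
    rootForm (x + Pi.single i c) =
      rootForm x + 2 * c * ∑ k, x k + 2 * c * x i + 2 * c ^ 2 := by
  have h : ∀ k, (x k + (Pi.single i c : Fin n → ℝ) k) ^ 2 =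
      x k ^ 2 + (if k = i then 2 * c * x i + c ^ 2 else 0) := by
    intro k
    by_cases hk : k = i
    · subst hk; simp; ring
    · simp [hk]
  simp only [rootForm, Pi.add_apply, h, Finset.sum_add_distrib, Finset.sum_ite_eq',
    Finset.mem_univ, if_true, Finset.sum_pi_single']
  ring

lemma nrm_vecMul_eq_sqrt_rootForm {n : ℕ} (G : Matrix (Fin n) (Fin n) ℝ)
    (hGram : G * G.transpose = Matrix.of (fun _ _ => (1 : ℝ)) + 1) (x : Fin n → ℝ) :
    nrm (x ᵥ* G) = Real.sqrt (rootForm x) := by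
  have h : ∑ i, (x ᵥ* G) i ^ 2 = x ᵥ* (G * G.transpose) ⬝ᵥ x := by
    rw [← Matrix.vecMul_vecMul, ← Matrix.dotProduct_mulVec, Matrix.mulVec_transpose]
    simp [dotProduct, sq]
  rw [nrm, h, hGram, Matrix.vecMul_add, Matrix.vecMul_one, add_dotProduct]
  congr 1
  simp [rootForm, dotProduct, Matrix.vecMul, sq, Finset.mul_sum]

/-- The total `ℓ¹` distance of an integer vector to the cube `{0,1}ⁿ`. -/
def cubeDist {n : ℕ} (z : Fin n → ℤ) : ℕ := ∑ i, ((z i - 1).toNat + (-z i).toNat)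

lemma cubeDist_lt {n : ℕ} {z w : Fin n → ℤ} (i : Fin n)
    (hle : ∀ k, (w k - 1).toNat + (-w k).toNat ≤ (z k - 1).toNat + (-z k).toNat)
    (hlt : (w i - 1).toNat + (-w i).toNat < (z i - 1).toNat + (-z i).toNat) :
    cubeDist w < cubeDist z :=
  Finset.sum_lt_sum (fun k _ => hle k) ⟨i, Finset.mem_univ i, hlt⟩

lemma sub_intCast_add_single {n : ℕ} (α : Fin n → ℝ) (z : Fin n → ℤ) (i : Fin n) (c : ℤ) :
    (fun k => α k - (((z + Pi.single i c : Fin n → ℤ) k : ℤ) : ℝ)) =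
      (fun k => α k - (z k : ℝ)) + Pi.single i (-(c : ℝ)) := by
  funext k
  by_cases hk : k = i
  · subst hk; simp; ring
  · simp [hk]

/-- Moving one step along `± gᵢ` or `± (gᵢ - gⱼ)` brings an integer vector outside the cube
closer to the cube without increasing its distance to `α`. -/
lemma exists_cubeDist_lt {n : ℕ} (α : Fin n → ℝ) (hα : ∀ i, 0 ≤ α i ∧ α i < 1)
    (z : Fin n → ℤ) (i : Fin n) (hi : ¬(z i = 0 ∨ z i = 1)) :
    ∃ w : Fin n → ℤ, cubeDist w < cubeDist z ∧
      rootForm (fun k => α k - w k) ≤ rootForm (fun k => α k - z k) := by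
  obtain ⟨hi0, hi1⟩ := hα i
  have hcase : 2 ≤ z i ∨ z i ≤ -1 := by omega
  rcases hcase with h | h
  · have hR : (2 : ℝ) ≤ z i := by exact_mod_cast h
    rcases le_or_gt (∑ k, (α k - (z k : ℝ))) 0 with hs | hs
    · refine ⟨z + Pi.single i (-1), cubeDist_lt i (fun k => ?_) ?_, ?_⟩
      · by_cases hk : k = i
        · subst hk; simp; omega
        · simp [hk]
      · simp; omega
      · rw [sub_intCast_add_single, rootForm_add_single]
        push_cast
        linarith
    · obtain ⟨j, -, hj⟩ := Finset.exists_lt_of_sum_lt (s := Finset.univ)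
        (f := fun _ => (0 : ℝ))
        (g := fun k => α k - (z k : ℝ)) (by rwa [Finset.sum_const_zero])
      obtain ⟨-, hj1⟩ := hα j
      have hzj : z j ≤ 0 := by
        have : (z j : ℝ) < 1 := by linarith
        have : z j < 1 := by exact_mod_cast this
        omega
      have hij : i ≠ j := by rintro rfl; omega
      refine ⟨z + Pi.single i (-1) + Pi.single j 1, cubeDist_lt i (fun k => ?_) ?_, ?_⟩
      · by_cases hk : k = i
        · subst hk; simp [hij]; omega
        · by_cases hkj : k = j
          · subst hkj; simp [hk]; omega
          · simp [hk, hkj]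
      · simp [hij]; omega
      · rw [sub_intCast_add_single, sub_intCast_add_single, rootForm_add_single,
          rootForm_add_single]
        simp only [Pi.add_apply, Finset.sum_add_distrib, Finset.sum_pi_single',
          Finset.mem_univ, if_true, Pi.single_eq_of_ne hij.symm]
        push_cast
        linarith
  · have hR : (z i : ℝ) ≤ -1 := by exact_mod_cast h
    rcases le_or_gt 0 (∑ k, (α k - (z k : ℝ))) with hs | hs
    · refine ⟨z + Pi.single i 1, cubeDist_lt i (fun k => ?_) ?_, ?_⟩
      · by_cases hk : k = i
        · subst hk; simp; omega
        · simp [hk]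
      · simp; omega
      · rw [sub_intCast_add_single, rootForm_add_single]
        push_cast
        linarith
    · obtain ⟨j, -, hj⟩ := Finset.exists_lt_of_sum_lt (s := Finset.univ)
        (f := fun k => α k - (z k : ℝ))
        (g := fun _ => (0 : ℝ)) (by rwa [Finset.sum_const_zero])
      obtain ⟨hj0, -⟩ := hα j
      have hzj : 1 ≤ z j := by
        have : (0 : ℝ) < z j := by linarith
        have : 0 < z j := by exact_mod_cast this
        omega
      have hij : i ≠ j := by rintro rfl; omega
      refine ⟨z + Pi.single i 1 + Pi.single j (-1), cubeDist_lt i (fun k => ?_) ?_, ?_⟩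
      · by_cases hk : k = i
        · subst hk; simp [hij]; omega
        · by_cases hkj : k = j
          · subst hkj; simp [hk]; omega
          · simp [hk, hkj]
      · simp [hij]; omega
      · rw [sub_intCast_add_single, sub_intCast_add_single, rootForm_add_single,
          rootForm_add_single]
        simp only [Pi.add_apply, Finset.sum_add_distrib, Finset.sum_pi_single',
          Finset.mem_univ, if_true, Pi.single_eq_of_ne hij.symm]
        push_cast
        linarith

lemma exists_cube_rootForm_le {n : ℕ} (α : Fin n → ℝ) (hα : ∀ i, 0 ≤ α i ∧ α i < 1)
    (z : Fin n → ℤ) :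
    ∃ w : Fin n → ℤ, (∀ i, w i = 0 ∨ w i = 1) ∧
      rootForm (fun k => α k - w k) ≤ rootForm (fun k => α k - z k) := by
  induction hd : cubeDist z using Nat.strong_induction_on generalizing z with
  | _ d ih =>
    subst hd
    by_cases hz : ∀ i, z i = 0 ∨ z i = 1
    · exact ⟨z, hz, le_rfl⟩
    · obtain ⟨i, hi⟩ := not_forall.mp hz
      obtain ⟨w, hlt, hle⟩ := exists_cubeDist_lt α hα z i hi
      obtain ⟨v, hv, hvw⟩ := ih _ hlt w rfl
      exact ⟨v, hv, hvw.trans hle⟩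

/-- a basis of `Aₙ` with Gram matrix `Jₙ + Iₙ` is Voronoi-reduced. -/
theorem An_basis_is_voronoi_reduced (n : ℕ) (hn : 1 ≤ n)
    (G : Matrix (Fin n) (Fin n) ℝ) (hG : IsUnit G.det)
    (hGram : G * G.transpose = Matrix.of (fun _ _ => (1 : ℝ)) + 1) :
    ∀ α : Fin n → ℝ, (∀ i, 0 ≤ α i ∧ α i < 1) →
      ∃ zhat : Fin n → ℝ, (∀ i, zhat i = 0 ∨ zhat i = 1) ∧
        ∀ z : Fin n → ℤ,
          nrm (α ᵥ* G - zhat ᵥ* G) ≤ nrm (α ᵥ* G - (fun i => (z i : ℝ)) ᵥ* G) := by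
  intro α hα
  have hfin : {w : Fin n → ℤ | ∀ i, w i = 0 ∨ w i = 1}.Finite := by
    have := Set.Finite.pi' (ι := Fin n) (fun _ => Set.toFinite ({0, 1} : Set ℤ))
    simpa using this
  obtain ⟨w, hw, hmin⟩ := Set.exists_min_image _ (fun w => rootForm (fun k => α k - (w k : ℝ)))
    hfin ⟨0, fun _ => Or.inl rfl⟩
  refine ⟨fun i => (w i : ℝ), fun i => (hw i).imp (fun h => by simp [h]) (fun h => by simp [h]), fun z => ?_⟩
  rw [← Matrix.sub_vecMul, ← Matrix.sub_vecMul, nrm_vecMul_eq_sqrt_rootForm G hGram,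
    nrm_vecMul_eq_sqrt_rootForm G hGram]
  obtain ⟨v, hv, hvz⟩ := exists_cube_rootForm_le α hα z
  exact Real.sqrt_le_sqrt ((hmin v hv).trans hvz)
end

section
/- Let G be an invertible 8×8 real matrix such that G·Gᵀ equals the matrix Γ_{E₈} with rows (4,2,0,2,2,2,2,2), (2,4,2,0,2,2,2,2), (0,2,4,0,2,2,0,0), (2,0,0,4,2,2,0,0), (2,2,2,2,4,2,2,0), (2,2,2,2,2,4,0,2), (2,2,0,0,2,0,4,0), (2,2,0,0,0,2,0,4) (a Gram matrix of the lattice E₈). Then the basis given by the rows of G is Voronoi-reduced with respect to the interior of the fundamental parallelotope: for every y = αG with α ∈ (0,1)⁸ there exists ẑ ∈ {0,1}⁸ such that ‖y − ẑG‖ ≤ ‖y − zG‖ for every z ∈ ℤ⁸. -/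
open Matrix

/-- Twice the inverse of the Gram matrix. Its rows are the coordinates of lattice vectors spanning
the dual directions; all of them are minimal vectors. -/
def dualCoords : Matrix (Fin 8) (Fin 8) ℤ :=
  !![2,0,0,-1,0,0,-1,-1;
     0,2,-1,0,0,0,-1,-1;
     0,-1,2,1,-1,-1,1,1;
     -1,0,1,2,-1,-1,1,1;
     0,0,-1,-1,2,0,-1,0;
     0,0,-1,-1,0,2,0,-1;
     -1,-1,1,1,-1,0,2,1;
     -1,-1,1,1,0,-1,1,2]

lemma dualCoords_mul_gram : dualCoords *
    (!![4,2,0,2,2,2,2,2;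
        2,4,2,0,2,2,2,2;
        0,2,4,0,2,2,0,0;
        2,0,0,4,2,2,0,0;
        2,2,2,2,4,2,2,0;
        2,2,2,2,2,4,0,2;
        2,2,0,0,2,0,4,0;
        2,2,0,0,0,2,0,4] : Matrix (Fin 8) (Fin 8) ℤ) = (2 : ℤ) • 1 := by
  decide +kernel

lemma dualCoords_diag (i : Fin 8) : dualCoords i i = 2 := by
  revert i; decide

lemma nrm_eq_sqrt_dotProduct {n : ℕ} (v : Fin n → ℝ) : nrm v = √(v ⬝ᵥ v) := by
  simp [nrm, dotProduct, sq]

section DualRows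

variable {n : ℕ} {G : Matrix (Fin n) (Fin n) ℝ} {W : Matrix (Fin n) (Fin n) ℤ}

lemma dotProduct_dual_row (hW : W.map (Int.cast : ℤ → ℝ) * (G * Gᵀ) = (2 : ℝ) • 1)
    (i : Fin n) (b : Fin n → ℝ) :
    (fun k => (W i k : ℝ)) ᵥ* G ⬝ᵥ b ᵥ* G = 2 * b i := by
  have h : W.map (Int.cast : ℤ → ℝ) *ᵥ (G *ᵥ (b ᵥ* G)) = (2 : ℝ) • b := by
    rw [← mulVec_transpose G b, mulVec_mulVec, mulVec_mulVec, Matrix.mul_assoc, hW, smul_mulVec, one_mulVec]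
  rw [← dotProduct_mulVec]
  exact congrFun h i

lemma sq_coord_le (hW : W.map (Int.cast : ℤ → ℝ) * (G * Gᵀ) = (2 : ℝ) • 1)
    (hd : ∀ i, W i i = 2) (b : Fin n → ℝ) (i : Fin n) :
    b i ^ 2 ≤ b ᵥ* G ⬝ᵥ b ᵥ* G := by
  have hcross := dotProduct_dual_row hW i b
  have hself := dotProduct_dual_row hW i (fun k => (W i k : ℝ))
  set u := (fun k => (W i k : ℝ)) ᵥ* G
  have hnonneg : 0 ≤ ((2 : ℝ) • (b ᵥ* G) - b i • u) ⬝ᵥ ((2 : ℝ) • (b ᵥ* G) - b i • u) :=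
    Finset.sum_nonneg fun _ _ => mul_self_nonneg _
  simp only [sub_dotProduct, dotProduct_sub, smul_dotProduct, dotProduct_smul, smul_eq_mul,
    dotProduct_comm (b ᵥ* G) u, hcross, hself, hd i] at hnonneg
  push_cast at hnonneg
  nlinarith

/-- Vectors of the Voronoi cell of the origin have coordinates at most `1` in absolute value when
the dual basis consists of lattice vectors as in `hW`. -/
lemma abs_coord_le_one_of_minimal (hW : W.map (Int.cast : ℤ → ℝ) * (G * Gᵀ) = (2 : ℝ) • 1)
    (hd : ∀ i, W i i = 2) (b : Fin n → ℝ)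
    (hb : ∀ z : Fin n → ℤ,
      b ᵥ* G ⬝ᵥ b ᵥ* G ≤ (b - fun k => (z k : ℝ)) ᵥ* G ⬝ᵥ (b - fun k => (z k : ℝ)) ᵥ* G)
    (i : Fin n) : |b i| ≤ 1 := by
  have hcross := dotProduct_dual_row hW i b
  have hself := dotProduct_dual_row hW i (fun k => (W i k : ℝ))
  have hpos := hb (W i)
  have hneg := hb (-W i)
  have hcast : (fun k => (((-W i) k : ℤ) : ℝ)) = -fun k => (W i k : ℝ) := by
    ext k; simp
  rw [hcast] at hneg
  simp only [sub_vecMul, neg_vecMul, sub_dotProduct, dotProduct_sub, neg_dotProduct,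
    dotProduct_neg, dotProduct_comm (b ᵥ* G), hcross, hself, hd i] at hpos hneg
  push_cast at hpos hneg
  rw [abs_le]
  constructor <;> linarith

lemma exists_closest (hW : W.map (Int.cast : ℤ → ℝ) * (G * Gᵀ) = (2 : ℝ) • 1)
    (hd : ∀ i, W i i = 2) (a : Fin n → ℝ) :
    ∃ x : Fin n → ℤ, ∀ z : Fin n → ℤ,
      (a - fun k => (x k : ℝ)) ᵥ* G ⬝ᵥ (a - fun k => (x k : ℝ)) ᵥ* G ≤
        (a - fun k => (z k : ℝ)) ᵥ* G ⬝ᵥ (a - fun k => (z k : ℝ)) ᵥ* G := by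
  set f : (Fin n → ℤ) → ℝ := fun z =>
    (a - fun k => (z k : ℝ)) ᵥ* G ⬝ᵥ (a - fun k => (z k : ℝ)) ᵥ* G
  have hfin : {z | f z ≤ f 0}.Finite := by
    refine (Set.finite_Icc (fun i => ⌊a i - √(f 0)⌋) (fun i => ⌈a i + √(f 0)⌉)).subset ?_
    intro z hz
    have hcoord (i : Fin n) : |a i - z i| ≤ √(f 0) :=
      Real.abs_le_sqrt ((sq_coord_le hW hd (a - fun k => (z k : ℝ)) i).trans hz)
    refine ⟨fun i => ?_, fun i => ?_⟩ <;> have := abs_le.mp (hcoord i)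
    · exact_mod_cast (Int.floor_le _).trans (by linarith : a i - √(f 0) ≤ (z i : ℝ))
    · exact_mod_cast (by linarith : (z i : ℝ) ≤ a i + √(f 0)).trans (Int.le_ceil _)
  obtain ⟨x, hx, hmin⟩ := Set.exists_min_image _ f hfin ⟨0, le_refl (f 0)⟩
  refine ⟨x, fun z => ?_⟩
  by_cases hz : f z ≤ f 0
  · exact hmin z hz
  · exact le_trans hx (not_le.mp hz).le

end DualRows

/-- a basis of `E₈` with the given Gram matrix is Voronoi-reduced with
respect to the interior of the fundamental parallelotope. -/
theorem E8_basis_is_voronoi_reduced_on_interior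
    (G : Matrix (Fin 8) (Fin 8) ℝ) (hG : IsUnit G.det)
    (hGram : G * G.transpose =
      !![4,2,0,2,2,2,2,2;
         2,4,2,0,2,2,2,2;
         0,2,4,0,2,2,0,0;
         2,0,0,4,2,2,0,0;
         2,2,2,2,4,2,2,0;
         2,2,2,2,2,4,0,2;
         2,2,0,0,2,0,4,0;
         2,2,0,0,0,2,0,4]) :
    ∀ α : Fin 8 → ℝ, (∀ i, 0 < α i ∧ α i < 1) →
      ∃ zhat : Fin 8 → ℝ, (∀ i, zhat i = 0 ∨ zhat i = 1) ∧
        ∀ z : Fin 8 → ℤ,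
          nrm (α ᵥ* G - zhat ᵥ* G) ≤ nrm (α ᵥ* G - (fun i => (z i : ℝ)) ᵥ* G) := by
  intro α hα
  have hW : dualCoords.map (Int.cast : ℤ → ℝ) * (G * Gᵀ) = (2 : ℝ) • 1 := by
    rw [hGram]
    have h := congrArg (fun M => M.map (Int.castRingHom ℝ)) dualCoords_mul_gram
    simp only [Matrix.map_mul] at h
    convert h using 1
    · congr 1
      ext i j
      fin_cases i <;> fin_cases j <;> simp
    · ext i j
      simp only [Matrix.map_apply, Matrix.smul_apply, one_apply]
      split_ifs <;> simp
  obtain ⟨x, hx⟩ := exists_closest hW dualCoords_diag α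
  refine ⟨fun k => x k, fun i => ?_, fun z => ?_⟩
  · have hle := abs_le.mp <| abs_coord_le_one_of_minimal hW dualCoords_diag
      (α - fun k => (x k : ℝ)) (fun z => by
        convert hx (x + z) using 3 <;> (ext k; simp [sub_sub])) i
    simp only [Pi.sub_apply] at hle
    have hlow : (-1 : ℝ) < x i := by linarith [(hα i).1]
    have hupp : (x i : ℝ) < 2 := by linarith [(hα i).2]
    have hlow' : -1 < x i := by exact_mod_cast hlow
    have hupp' : x i < 2 := by exact_mod_cast hupp
    have hx01 : x i = 0 ∨ x i = 1 := by lia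
    exact hx01.imp (fun h => by simp [h]) (fun h => by simp [h])
  · rw [← sub_vecMul, ← sub_vecMul, nrm_eq_sqrt_dotProduct, nrm_eq_sqrt_dotProduct]
    exact Real.sqrt_le_sqrt (hx z)
end

section
/- Let G be an invertible 8×8 real matrix with rows g₁,…,g₈, let u₁,…,u₈ denote the columns of G⁻¹, and let Λ = {zG : z ∈ ℤ⁸} with dual lattice Λ* = {u ∈ ℝ⁸ : ⟨u,x⟩ ∈ ℤ for all x ∈ Λ}. Assume: (i) the matrix (1/2)·G·Gᵀ has integer entries, even diagonal entries, and determinant 1 (so Λ is a copy of E₈ scaled to minimum distance 2); (ii) every nonzero x ∈ Λ satisfies ‖x‖² ≥ 4, and ‖gᵢ‖² = 4 for every i (all basis vectors lie in the first lattice shell); (iii) every nonzero u ∈ Λ* satisfies ‖u‖² ≥ 1, and ‖uᵢ‖² = 1 for every i (all dual basis vectors lie in the first shell of the dual). Then the basis is Voronoi-reduced with respect to the interior of the fundamental parallelotope: for every y = αG with α ∈ (0,1)⁸ there exists ẑ ∈ {0,1}⁸ such that ‖y − ẑG‖ ≤ ‖y − zG‖ for every z ∈ ℤ⁸. -/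
open Matrix

/-- The lattice generated by the rows of `G`. -/
def latticePt {n : ℕ} (G : Matrix (Fin n) (Fin n) ℝ) (x : Fin n → ℝ) : Prop :=
  ∃ z : Fin n → ℤ, x = (fun i => (z i : ℝ)) ᵥ* G

/-- Membership in the dual lattice: all inner products with lattice points are integers. -/
def dualPt {n : ℕ} (G : Matrix (Fin n) (Fin n) ℝ) (u : Fin n → ℝ) : Prop :=
  ∀ x : Fin n → ℝ, latticePt G x → ∃ m : ℤ, ∑ j, u j * x j = (m : ℝ)

lemma dotProduct_self_real_nonneg {n : ℕ} (v : Fin n → ℝ) : 0 ≤ v ⬝ᵥ v :=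
  Finset.sum_nonneg fun i _ => mul_self_nonneg (v i)

lemma nrm_le_nrm_iff {n : ℕ} (v w : Fin n → ℝ) : nrm v ≤ nrm w ↔ v ⬝ᵥ v ≤ w ⬝ᵥ w := by
  have sum_sq (x : Fin n → ℝ) : ∑ i, x i ^ 2 = x ⬝ᵥ x := by simp [dotProduct, sq]
  rw [nrm, nrm, sum_sq, sum_sq]
  exact Real.sqrt_le_sqrt_iff (dotProduct_self_real_nonneg w)

/-- The `i`-th coordinate of a vector in the row basis is its pairing with the dual vector. -/
lemma vecMul_dotProduct_col_inv {n : ℕ} {G : Matrix (Fin n) (Fin n) ℝ} (hG : IsUnit G.det)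
    (β : Fin n → ℝ) (i : Fin n) : (β ᵥ* G) ⬝ᵥ (fun j => G⁻¹ j i) = β i := by
  change ((β ᵥ* G) ᵥ* G⁻¹) i = β i
  rw [vecMul_vecMul, mul_nonsing_inv G hG, vecMul_one]

/-- If the Gram matrix is twice a unimodular integer matrix, then twice each dual basis vector
lies in the lattice. -/
lemma exists_int_vecMul_eq_two_smul_col_inv {n : ℕ} {G : Matrix (Fin n) (Fin n) ℝ}
    (hG : IsUnit G.det) {M : Matrix (Fin n) (Fin n) ℤ}
    (hM : ∀ i j, (G * G.transpose) i j = 2 * (M i j : ℝ)) (hdet : M.det = 1) (i : Fin n) :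
    ∃ w : Fin n → ℤ, (fun k => (w k : ℝ)) ᵥ* G = (2 : ℝ) • fun j => G⁻¹ j i := by
  have gram : G * Gᵀ = (2 : ℝ) • M.map (Int.cast : ℤ → ℝ) := by
    ext a b
    simp [hM]
  have hadj : M.adjugate.map (Int.cast : ℤ → ℝ) * M.map (Int.cast : ℤ → ℝ) = 1 := by
    rw [← Matrix.map_mul_intCast, adjugate_mul, hdet, one_smul]
    exact Matrix.map_one _ Int.cast_zero Int.cast_one
  have hprod : M.adjugate.map (Int.cast : ℤ → ℝ) * G = (2 : ℝ) • (G⁻¹)ᵀ := by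
    have hGT : IsUnit Gᵀ.det := by rwa [det_transpose]
    have h : M.adjugate.map (Int.cast : ℤ → ℝ) * G * Gᵀ = (2 : ℝ) • (1 : Matrix _ _ ℝ) := by
      rw [Matrix.mul_assoc, gram, Matrix.mul_smul, hadj]
    have h' := congrArg (· * (Gᵀ)⁻¹) h
    simpa [Matrix.mul_assoc, mul_nonsing_inv _ hGT, transpose_nonsing_inv] using h'
  refine ⟨M.adjugate i, funext fun j => ?_⟩
  have h := congrFun (congrFun hprod i) j
  simpa [Matrix.mul_apply, vecMul, dotProduct] using h

/-- A vector has a closest point in a full-rank lattice. -/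
lemma exists_closest_latticePt {n : ℕ} {G : Matrix (Fin n) (Fin n) ℝ} (hG : IsUnit G.det)
    (α : Fin n → ℝ) : ∃ z₀ : Fin n → ℤ, ∀ z : Fin n → ℤ,
      nrm (α ᵥ* G - (fun i => (z₀ i : ℝ)) ᵥ* G) ≤ nrm (α ᵥ* G - (fun i => (z i : ℝ)) ᵥ* G) := by
  let d : (Fin n → ℤ) → ℝ := fun z =>
    (α ᵥ* G - (fun i => (z i : ℝ)) ᵥ* G) ⬝ᵥ (α ᵥ* G - (fun i => (z i : ℝ)) ᵥ* G)
  have hfin : {z | d z ≤ d 0}.Finite := by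
    let r : Fin n → ℝ := fun i => d 0 + (fun j => G⁻¹ j i) ⬝ᵥ (fun j => G⁻¹ j i)
    refine (Set.finite_Icc (fun i => ⌈α i - r i⌉) (fun i => ⌊α i + r i⌋)).subset ?_
    intro z hz
    have bound (i : Fin n) : |α i - z i| ≤ r i := by
      set u : Fin n → ℝ := fun j => G⁻¹ j i
      set v := (α - fun i => (z i : ℝ)) ᵥ* G with hv
      have hvu : v ⬝ᵥ u = α i - z i := vecMul_dotProduct_col_inv hG _ i
      have hvv : v ⬝ᵥ v ≤ d 0 := by
        rw [hv, sub_vecMul]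
        exact hz
      have h₁ : 0 ≤ (v - u) ⬝ᵥ (v - u) := dotProduct_self_real_nonneg _
      have h₂ : 0 ≤ (v + u) ⬝ᵥ (v + u) := dotProduct_self_real_nonneg _
      have h₃ : 0 ≤ v ⬝ᵥ v := dotProduct_self_real_nonneg _
      have h₄ : 0 ≤ u ⬝ᵥ u := dotProduct_self_real_nonneg _
      simp only [sub_dotProduct, dotProduct_sub, add_dotProduct, dotProduct_add,
        dotProduct_comm u v] at h₁ h₂
      rw [← hvu, abs_le]
      constructor <;> simp only [r] <;> linarith
    refine ⟨fun i => ?_, fun i => ?_⟩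
    · exact Int.ceil_le.2 (by linarith [(abs_le.1 (bound i)).2])
    · exact Int.le_floor.2 (by linarith [(abs_le.1 (bound i)).1])
  obtain ⟨z₀, hz₀, hmin⟩ := Set.exists_min_image _ d hfin ⟨0, le_refl (d 0)⟩
  refine ⟨z₀, fun z => (nrm_le_nrm_iff _ _).2 ?_⟩
  rcases le_total (d z) (d 0) with h | h
  · exact hmin z h
  · exact le_trans hz₀ h

/-- an `E₈` basis (scaled to minimum distance 2) all of whose vectors, and all
of whose dual basis vectors, lie in the respective first shells, is Voronoi-reduced with
respect to the interior of the fundamental parallelotope. -/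
theorem E8_first_shell_basis_is_VR_on_interior
    (G : Matrix (Fin 8) (Fin 8) ℝ) (hG : IsUnit G.det)
    -- (i) (1/2)·G·Gᵀ has integer entries, even diagonal entries, and determinant 1
    (hEven : ∃ M : Matrix (Fin 8) (Fin 8) ℤ,
      (∀ i j, (G * G.transpose) i j = 2 * (M i j : ℝ)) ∧
      (∀ i, Even (M i i)) ∧ M.det = 1)
    -- (ii) all nonzero lattice points have squared norm ≥ 4, rows are in the first shell
    (hmin : ∀ x : Fin 8 → ℝ, latticePt G x → x ≠ 0 → 4 ≤ ∑ j, x j ^ 2)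
    (hrows : ∀ i, ∑ j, G i j ^ 2 = 4)
    -- (iii) all nonzero dual lattice points have squared norm ≥ 1, columns of G⁻¹
    -- are in the first shell of the dual
    (hdualmin : ∀ u : Fin 8 → ℝ, dualPt G u → u ≠ 0 → 1 ≤ ∑ j, u j ^ 2)
    (hcols : ∀ i, ∑ j, (G⁻¹ j i) ^ 2 = 1) :
    ∀ α : Fin 8 → ℝ, (∀ i, 0 < α i ∧ α i < 1) →
      ∃ zhat : Fin 8 → ℝ, (∀ i, zhat i = 0 ∨ zhat i = 1) ∧
        ∀ z : Fin 8 → ℤ,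
          nrm (α ᵥ* G - zhat ᵥ* G) ≤ nrm (α ᵥ* G - (fun i => (z i : ℝ)) ᵥ* G) := by
  intro α hα
  obtain ⟨M, hM, -, hdet⟩ := hEven
  obtain ⟨z₀, hz₀⟩ := exists_closest_latticePt hG α
  refine ⟨fun i => (z₀ i : ℝ), fun i => ?_, hz₀⟩
  obtain ⟨w, hw⟩ := exists_int_vecMul_eq_two_smul_col_inv hG hM hdet i
  set u : Fin 8 → ℝ := fun j => G⁻¹ j i
  set v := (α - fun i => (z₀ i : ℝ)) ᵥ* G with hv
  have hvu : v ⬝ᵥ u = α i - z₀ i := vecMul_dotProduct_col_inv hG _ i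
  have huu : u ⬝ᵥ u = 1 := by simpa [dotProduct, sq] using hcols i
  have hadd := (nrm_le_nrm_iff _ _).1 (hz₀ (z₀ + w))
  have hsub := (nrm_le_nrm_iff _ _).1 (hz₀ (z₀ - w))
  have eq_add : α ᵥ* G - (fun i => ((z₀ + w) i : ℝ)) ᵥ* G = v - (2 : ℝ) • u := by
    rw [hv, ← hw, ← sub_vecMul, ← sub_vecMul]
    congr 1
    ext k
    simp only [Pi.sub_apply, Pi.add_apply, Int.cast_add]
    ring
  have eq_sub : α ᵥ* G - (fun i => ((z₀ - w) i : ℝ)) ᵥ* G = v + (2 : ℝ) • u := by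
    rw [hv, ← hw, ← sub_vecMul, ← add_vecMul]
    congr 1
    ext k
    simp only [Pi.sub_apply, Pi.add_apply, Int.cast_sub]
    ring
  rw [eq_add, ← sub_vecMul, ← hv] at hadd
  rw [eq_sub, ← sub_vecMul, ← hv] at hsub
  simp only [sub_dotProduct, dotProduct_sub, add_dotProduct, dotProduct_add, smul_dotProduct,
    dotProduct_smul, smul_eq_mul, dotProduct_comm u v, huu, hvu] at hadd hsub
  obtain ⟨hα₀, hα₁⟩ := hα i
  have hlower : (-1 : ℝ) < z₀ i := by linarith
  have hupper : (z₀ i : ℝ) < 2 := by linarith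
  have hlower' : -1 < z₀ i := by exact_mod_cast hlower
  have hupper' : z₀ i < 2 := by exact_mod_cast hupper
  obtain h | h : z₀ i = 0 ∨ z₀ i = 1 := by omega
  · simp [h]
  · simp [h]
end

section
/- Let G be an invertible 24×24 real matrix and Λ = {zG : z ∈ ℤ²⁴}. Assume Λ equals its dual lattice Λ* = {u ∈ ℝ²⁴ : ⟨u,x⟩ ∈ ℤ for all x ∈ Λ} (Λ is unimodular) and that the minimum squared norm of a nonzero lattice point is 4, i.e. min{‖x‖² : x ∈ Λ, x ≠ 0} = 4 (these properties characterize the Leech lattice Λ₂₄). Then the basis given by the rows of G is not Voronoi-reduced: there exist y = αG with α ∈ [0,1)²⁴ and x ∈ Λ such that ‖y − x‖ < ‖y − ẑG‖ for every ẑ ∈ {0,1}²⁴. Since G is an arbitrary generator matrix, no basis of the Leech lattice is Voronoi-reduced. -/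
open Matrix

/-- In a lattice with minimum squared norm at least `4`, the origin is strictly closer than any
other lattice vector `w` to a point `y` of squared norm less than `1`. -/
lemma sum_sq_lt_sum_sub_sq {ι : Type*} [Fintype ι] (y w : ι → ℝ)
    (hy : ∑ j, y j ^ 2 < 1) (hw : 4 ≤ ∑ j, w j ^ 2) :
    ∑ j, y j ^ 2 < ∑ j, (y j - w j) ^ 2 := by
  have h : 0 ≤ ∑ j, (2 * y j - w j) ^ 2 := Finset.sum_nonneg fun j _ => sq_nonneg _
  have e₁ : ∑ j, (2 * y j - w j) ^ 2 =
      4 * ∑ j, y j ^ 2 - 4 * ∑ j, y j * w j + ∑ j, w j ^ 2 := by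
    simp only [Finset.mul_sum, ← Finset.sum_sub_distrib, ← Finset.sum_add_distrib]
    exact Finset.sum_congr rfl fun j _ => by ring
  have e₂ : ∑ j, (y j - w j) ^ 2 =
      ∑ j, y j ^ 2 - 2 * ∑ j, y j * w j + ∑ j, w j ^ 2 := by
    simp only [Finset.mul_sum, ← Finset.sum_sub_distrib, ← Finset.sum_add_distrib]
    exact Finset.sum_congr rfl fun j _ => by ring
  linarith

/-- The columns of `G⁻¹` form the dual basis, so they lie in the dual lattice. -/
lemma dualPt_col_inv {n : ℕ} (G : Matrix (Fin n) (Fin n) ℝ) (hG : IsUnit G.det) (i : Fin n) :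
    dualPt G (fun j => G⁻¹ j i) := by
  rintro _ ⟨z, rfl⟩
  refine ⟨z i, ?_⟩
  have h : ((fun k => (z k : ℝ)) ᵥ* G) ᵥ* G⁻¹ = fun k => (z k : ℝ) := by
    rw [vecMul_vecMul, mul_nonsing_inv G hG, vecMul_one]
  rw [← congrFun h i]
  exact Finset.sum_congr rfl fun j _ => mul_comm _ _


/-- no basis of the Leech lattice (a unimodular lattice in dimension 24 with
minimum squared norm 4) is Voronoi-reduced. -/
theorem leech_has_no_voronoi_reduced_basis
    (G : Matrix (Fin 24) (Fin 24) ℝ) (hG : IsUnit G.det)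
    -- Λ is self-dual (unimodular)
    (hself : {x : Fin 24 → ℝ | latticePt G x} = {u : Fin 24 → ℝ | dualPt G u})
    -- the minimum squared norm of a nonzero lattice point is 4
    (hmin : (∀ x : Fin 24 → ℝ, latticePt G x → x ≠ 0 → 4 ≤ ∑ j, x j ^ 2) ∧
      (∃ x : Fin 24 → ℝ, latticePt G x ∧ x ≠ 0 ∧ ∑ j, x j ^ 2 = 4)) :
    ∃ α : Fin 24 → ℝ, (∀ i, 0 ≤ α i ∧ α i < 1) ∧
      ∃ x : Fin 24 → ℝ, latticePt G x ∧
        ∀ zhat : Fin 24 → ℝ, (∀ i, zhat i = 0 ∨ zhat i = 1) →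
          nrm (α ᵥ* G - x) < nrm (α ᵥ* G - zhat ᵥ* G) := by
  set d : Fin 24 → ℝ := fun j => G⁻¹ j 0 with hd
  have hdl : latticePt G d := by
    have h : d ∈ {u : Fin 24 → ℝ | dualPt G u} := dualPt_col_inv G hG 0
    rwa [← hself] at h
  have hd0 : d ≠ 0 := by
    intro h
    have h1 : (G * G⁻¹) 0 0 = 1 := by rw [mul_nonsing_inv G hG, one_apply_eq]
    rw [mul_apply, Finset.sum_eq_zero] at h1
    · exact zero_ne_one h1
    · intro j _
      rw [show G⁻¹ j 0 = 0 from congrFun h j, mul_zero]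
  have hN := hmin.1 d hdl hd0
  set N := ∑ j, d j ^ 2 with hNdef
  have hNpos : 0 < N := by linarith
  set y : Fin 24 → ℝ := fun j => 3 / (2 * N) * d j with hy
  have hyN : ∑ j, y j ^ 2 < 1 := by
    have e : ∑ j, y j ^ 2 = 9 / (4 * N) := by
      simp only [hy, mul_pow, ← Finset.mul_sum, ← hNdef]
      field_simp
      norm_num
    rw [e, div_lt_one (by linarith)]
    linarith
  set β := y ᵥ* G⁻¹ with hβ
  have hβG : β ᵥ* G = y := by rw [hβ, vecMul_vecMul, nonsing_inv_mul G hG, vecMul_one]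
  have hβ0 : β 0 = 3 / 2 := by
    have e : β 0 = 3 / (2 * N) * N := by
      rw [Finset.mul_sum]
      change ∑ j, 3 / (2 * N) * d j * d j = _
      exact Finset.sum_congr rfl fun j _ => by rw [sq, mul_assoc]
    rw [e]
    field_simp
  have hfloor : ⌊β 0⌋ = 1 := by rw [hβ0]; norm_num
  refine ⟨fun i => Int.fract (β i), fun i => ⟨Int.fract_nonneg _, Int.fract_lt_one _⟩,
    (fun i => ((-⌊β i⌋ : ℤ) : ℝ)) ᵥ* G, ⟨_, rfl⟩, fun zhat hz => ?_⟩
  have hx : (fun i => Int.fract (β i)) ᵥ* G - (fun i => ((-⌊β i⌋ : ℤ) : ℝ)) ᵥ* G = y := by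
    rw [← sub_vecMul, ← hβG]
    congr 1
    ext i
    simp only [Int.fract, Pi.sub_apply, Int.cast_neg]
    ring
  have hw : (fun i => Int.fract (β i)) ᵥ* G - zhat ᵥ* G =
      y - (fun i => (⌊β i⌋ : ℝ) + zhat i) ᵥ* G := by
    rw [← hβG, ← sub_vecMul, ← sub_vecMul]
    congr 1
    ext i
    simp only [Int.fract, Pi.sub_apply]
    ring
  set w := (fun i => (⌊β i⌋ : ℝ) + zhat i) ᵥ* G with hwdef
  have hwl : latticePt G w := by
    have hint : ∀ i, ∃ m : ℤ, (m : ℝ) = zhat i := fun i =>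
      (hz i).elim (fun h => ⟨0, by simp [h]⟩) fun h => ⟨1, by simp [h]⟩
    choose m hm using hint
    exact ⟨fun i => ⌊β i⌋ + m i, by simp [hwdef, hm]⟩
  have hw0 : w ≠ 0 := by
    intro h
    have h' : w ᵥ* G⁻¹ = fun i => (⌊β i⌋ : ℝ) + zhat i := by
      rw [hwdef, vecMul_vecMul, mul_nonsing_inv G hG, vecMul_one]
    have h1 := congrFun h' 0
    rw [h, zero_vecMul, Pi.zero_apply, hfloor] at h1
    rcases hz 0 with hz0 | hz0 <;> rw [hz0] at h1 <;> norm_num at h1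
  rw [hx, hw]
  exact Real.sqrt_lt_sqrt (Finset.sum_nonneg fun j _ => sq_nonneg _)
    (sum_sq_lt_sum_sub_sq y w hyN (hmin.1 w hwl hw0))
end

section
/- Let G be an invertible n×n real matrix with rows g₁,…,gₙ generating the lattice Λ = {zG : z ∈ ℤⁿ}, and let uᵢ denote the i-th column of G⁻¹, so that the uᵢ generate the dual lattice Λ*. Let d(Λ) = min{‖x‖ : x ∈ Λ, x ≠ 0} and d(Λ*) = min{‖u‖ : u ∈ Λ*, u ≠ 0}, and assume ‖gᵢ‖ = d(Λ) and ‖uᵢ‖ = d(Λ*) for every i (both bases consist of first-shell vectors). Define the nominal coding gains γ(Λ) = d(Λ)²/|det G|^{2/n} and γ(Λ*) = d(Λ*)²·|det G|^{2/n}, and let H_i be the linear hyperplane spanned by {g_j : j ≠ i}. Then every lattice point x ∈ Λ not lying on H_i satisfies dist(x, H_i) ≥ d(Λ)/(√γ(Λ*)·√γ(Λ)), and the point −gᵢ, which lies outside the closed fundamental parallelotope {αG : α ∈ [0,1]ⁿ}, attains this distance with equality. -/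
open Matrix

/-- Euclidean distance from a point to a set: `inf {‖y − s‖ : s ∈ S}`. -/
noncomputable def distS {n : ℕ} (y : Fin n → ℝ) (S : Set (Fin n → ℝ)) : ℝ :=
  sInf ((fun s => nrm (y - s)) '' S)

theorem nrm_nonneg {n : ℕ} (v : Fin n → ℝ) : 0 ≤ nrm v := Real.sqrt_nonneg _

theorem nrm_sq {n : ℕ} (v : Fin n → ℝ) : nrm v ^ 2 = v ⬝ᵥ v := by
  rw [nrm, Real.sq_sqrt (Finset.sum_nonneg fun i _ => sq_nonneg _)]
  simp only [dotProduct, sq]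

theorem nrm_smul {n : ℕ} (c : ℝ) (v : Fin n → ℝ) : nrm (c • v) = |c| * nrm v := by
  simp only [nrm, Pi.smul_apply, smul_eq_mul, mul_pow, ← Finset.mul_sum]
  rw [Real.sqrt_mul (sq_nonneg c), Real.sqrt_sq_eq_abs]

theorem nrm_pos {n : ℕ} {v : Fin n → ℝ} (hv : v ≠ 0) : 0 < nrm v := by
  refine (nrm_nonneg v).lt_of_ne' fun h => hv ?_
  rw [← dotProduct_self_eq_zero, ← nrm_sq, h]
  norm_num

theorem abs_dotProduct_le_nrm_mul_nrm {n : ℕ} (u v : Fin n → ℝ) :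
    |u ⬝ᵥ v| ≤ nrm u * nrm v := by
  rw [nrm, nrm, ← Real.sqrt_mul (Finset.sum_nonneg fun i _ => sq_nonneg _)]
  exact Real.abs_le_sqrt (Finset.sum_mul_sq_le_sq_mul_sq _ _ _)

/-- Distance from a point to the hyperplane through the origin orthogonal to `u`. -/
theorem distS_orthogonal_hyperplane {n : ℕ} {u : Fin n → ℝ} (hu : u ≠ 0) (y : Fin n → ℝ) :
    distS y {s | u ⬝ᵥ s = 0} = |u ⬝ᵥ y| / nrm u := by
  have hpos := nrm_pos hu
  refine IsLeast.csInf_eq ⟨⟨y - (u ⬝ᵥ y / nrm u ^ 2) • u, ?_, ?_⟩, ?_⟩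
  · simp only [Set.mem_ofPred_eq, dotProduct_sub, dotProduct_smul, smul_eq_mul, ← nrm_sq]
    field_simp
    ring
  · simp only [sub_sub_cancel, nrm_smul, abs_div, abs_of_pos (pow_pos hpos 2)]
    field_simp
  · rintro _ ⟨s, hs, rfl⟩
    rw [div_le_iff₀ hpos, mul_comm]
    have h := abs_dotProduct_le_nrm_mul_nrm u (y - s)
    rwa [dotProduct_sub, show u ⬝ᵥ s = 0 from hs, sub_zero] at h

/-- A column of `G⁻¹` reads off a coefficient with respect to the rows of `G`. -/
theorem inv_col_dotProduct_vecMul {n : ℕ} {G : Matrix (Fin n) (Fin n) ℝ} (hG : IsUnit G.det)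
    (i : Fin n) (c : Fin n → ℝ) : (fun j => G⁻¹ j i) ⬝ᵥ (c ᵥ* G) = c i := by
  have h : (c ᵥ* G) ᵥ* G⁻¹ = c := by
    rw [vecMul_vecMul, mul_nonsing_inv G hG, vecMul_one]
  rw [dotProduct_comm]
  exact congrFun h i

/-- A row of `G` pairs with a column of `G⁻¹` to an entry of the identity. -/
theorem inv_col_dotProduct_row {n : ℕ} {G : Matrix (Fin n) (Fin n) ℝ} (hG : IsUnit G.det)
    (i j : Fin n) : (fun k => G⁻¹ k i) ⬝ᵥ G j = if i = j then 1 else 0 := by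
  have h := inv_col_dotProduct_vecMul hG i (Pi.single j 1)
  rw [single_one_vecMul] at h
  exact h.trans (Pi.single_apply j 1 i)

/-- The span of the rows of `G` other than the `i`-th is the hyperplane orthogonal to the
`i`-th column of `G⁻¹`. -/
theorem span_rows_ne_eq_orthogonal_inv_col {n : ℕ} {G : Matrix (Fin n) (Fin n) ℝ}
    (hG : IsUnit G.det) (i : Fin n) :
    (Submodule.span ℝ {v : Fin n → ℝ | ∃ j, j ≠ i ∧ v = G j} : Set (Fin n → ℝ)) =
      {s | (fun j => G⁻¹ j i) ⬝ᵥ s = 0} := by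
  ext s
  simp only [SetLike.mem_coe, Set.mem_ofPred_eq]
  constructor
  · intro hs
    induction hs using Submodule.span_induction with
    | mem x hx =>
      obtain ⟨j, hj, rfl⟩ := hx
      rw [inv_col_dotProduct_row hG, if_neg hj.symm]
    | zero => exact dotProduct_zero _
    | add x y _ _ hx hy => rw [dotProduct_add, hx, hy, add_zero]
    | smul a x _ hx => rw [dotProduct_smul, hx, smul_zero]
  · intro hs
    have hc : s = (s ᵥ* G⁻¹) ᵥ* G := by
      rw [vecMul_vecMul, nonsing_inv_mul G hG, vecMul_one]
    have hci : (s ᵥ* G⁻¹) i = 0 := (dotProduct_comm _ _).trans hs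
    rw [hc, vecMul_eq_sum]
    refine Submodule.sum_mem _ fun j _ => ?_
    by_cases hj : j = i
    · rw [hj, hci, zero_smul]
      exact Submodule.zero_mem _
    · exact Submodule.smul_mem _ _ (Submodule.subset_span ⟨j, hj, rfl⟩)

/-- The determinant factors of the two coding gains cancel. -/
theorem div_sqrt_coding_gains {a b t : ℝ} (ha : 0 < a) (hb : 0 ≤ b) (ht : 0 < t) :
    a / (Real.sqrt (b ^ 2 * t) * Real.sqrt (a ^ 2 / t)) = 1 / b := by
  rw [← Real.sqrt_mul (by positivity), show b ^ 2 * t * (a ^ 2 / t) = (b * a) ^ 2 by field_simp,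
    Real.sqrt_sq (by positivity), mul_comm b a, ← div_div, div_self (ne_of_gt ha)]

/-- distance from lattice points outside the facet hyperplane `H_i` to `H_i`,
for a basis whose vectors and dual basis vectors are all first-shell vectors. -/
theorem dist_lattice_to_facet_hyperplane (n : ℕ) (hn : 0 < n)
    (G : Matrix (Fin n) (Fin n) ℝ) (hG : IsUnit G.det)
    (dL dLs : ℝ)
    -- d(Λ) is the minimum norm of a nonzero lattice point, attained by every row of G
    (hdL : ∀ x : Fin n → ℝ, latticePt G x → x ≠ 0 → dL ≤ nrm x)
    (hrows : ∀ i, nrm (G i) = dL)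
    -- d(Λ*) is the minimum norm of a nonzero dual lattice point, attained by every
    -- column of G⁻¹
    (hdLs : ∀ u : Fin n → ℝ, dualPt G u → u ≠ 0 → dLs ≤ nrm u)
    (hcols : ∀ i, nrm (fun j => G⁻¹ j i) = dLs)
    (i : Fin n) :
    -- nominal coding gains of Λ and Λ*, and the hyperplane H_i spanned by the other rows
    let γ : ℝ := dL ^ 2 / |G.det| ^ ((2 : ℝ) / n)
    let γs : ℝ := dLs ^ 2 * |G.det| ^ ((2 : ℝ) / n)
    let Hi : Set (Fin n → ℝ) := ↑(Submodule.span ℝ {v : Fin n → ℝ | ∃ j, j ≠ i ∧ v = G j})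
    (∀ x : Fin n → ℝ, latticePt G x → x ∉ Hi →
        dL / (Real.sqrt γs * Real.sqrt γ) ≤ distS x Hi) ∧
    (¬ ∃ α : Fin n → ℝ, (∀ t, 0 ≤ α t ∧ α t ≤ 1) ∧ -(G i) = α ᵥ* G) ∧
    distS (-(G i)) Hi = dL / (Real.sqrt γs * Real.sqrt γ) := by
  intro γ γs Hi
  set u : Fin n → ℝ := fun j => G⁻¹ j i with hu_def
  have hui : u ⬝ᵥ G i = 1 := by rw [inv_col_dotProduct_row hG, if_pos rfl]
  have hu : u ≠ 0 := fun h => by simp [h] at hui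
  have hGi : G i ≠ 0 := fun h => by simp [h] at hui
  have hnu : nrm u = dLs := hcols i
  have hdLs_pos : 0 < dLs := hnu ▸ nrm_pos hu
  have hHi : Hi = {s | u ⬝ᵥ s = 0} := span_rows_ne_eq_orthogonal_inv_col hG i
  rw [show dL / (Real.sqrt γs * Real.sqrt γ) = 1 / dLs from
    div_sqrt_coding_gains (hrows i ▸ nrm_pos hGi) hdLs_pos.le
      (Real.rpow_pos_of_pos (abs_pos.mpr hG.ne_zero) _), hHi]
  refine ⟨?_, ?_, ?_⟩
  · rintro x ⟨z, rfl⟩ hx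
    rw [distS_orthogonal_hyperplane hu, hnu]
    rw [Set.mem_ofPred_eq, inv_col_dotProduct_vecMul hG] at hx
    rw [inv_col_dotProduct_vecMul hG]
    gcongr
    exact_mod_cast Int.one_le_abs (by exact_mod_cast hx : z i ≠ 0)
  · rintro ⟨α, hα, h⟩
    have h' := congrArg (u ⬝ᵥ ·) h
    simp only [dotProduct_neg, hu_def, inv_col_dotProduct_vecMul hG] at h'
    linarith [(hα i).1]
  · rw [distS_orthogonal_hyperplane hu, hnu, dotProduct_neg, hui, abs_neg, abs_one]
end

section
/- Let 6 ≤ n ≤ 8 and let G be an invertible n×n real matrix whose rows g₁,…,gₙ have Gram matrix G·Gᵀ = Γ_{Eₙ}, where Γ_{Eₙ} has diagonal entries 2, entries 0 in positions (1,2),(2,1),(1,3),(3,1), and all other off-diagonal entries 1 (the Eₙ basis). For any pair (j,k) with either 4 ≤ j < k ≤ n or (j,k) = (2,3), the unique linear map T : ℝⁿ → ℝⁿ determined by T(g_j) = g_k, T(g_k) = g_j, and T(gᵢ) = gᵢ for i ∉ {j,k} is an orthogonal transformation equal to the reflection across the bisector hyperplane {y : ⟨y, g_j − g_k⟩ = 0};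 it maps Λ onto Λ, maps P(B) onto P(B), and maps C^b onto C^b for b ∈ {0,1}. Consequently, for every y ∈ ℝⁿ and b ∈ {0,1}, dist(T(y), C^b) = dist(y, C^b). -/
open Matrix Finset

/-- The fundamental parallelotope `P(B) = {αG : α ∈ [0,1)ⁿ}`. -/
def fundPar {n : ℕ} (G : Matrix (Fin n) (Fin n) ℝ) : Set (Fin n → ℝ) :=
  {x | ∃ α : Fin n → ℝ, (∀ i, 0 ≤ α i ∧ α i < 1) ∧ x = α ᵥ* G}

/-- The corner set `C^b = {zG : z ∈ {0,1}ⁿ, z₁ = b}`. -/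
def cornerSet {n : ℕ} [NeZero n] (G : Matrix (Fin n) (Fin n) ℝ) (b : ℝ) :
    Set (Fin n → ℝ) :=
  {x | ∃ z : Fin n → ℝ, (∀ i, z i = 0 ∨ z i = 1) ∧ z 0 = b ∧ x = z ᵥ* G}

/-- The `Eₙ` Gram matrix: diagonal entries `2`, entries `(1,2)`, `(2,1)`, `(1,3)`, `(3,1)`
equal to `0` (in 1-based indexing), all other off-diagonal entries `1`. -/
def gramE (n : ℕ) : Matrix (Fin n) (Fin n) ℝ :=
  Matrix.of fun i j =>
    if i = j then 2
    else if ((i : ℕ) = 0 ∧ (j : ℕ) = 1) ∨ ((i : ℕ) = 1 ∧ (j : ℕ) = 0) ∨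
            ((i : ℕ) = 0 ∧ (j : ℕ) = 2) ∨ ((i : ℕ) = 2 ∧ (j : ℕ) = 0) then 0 else 1

/-- The reflection across the hyperplane orthogonal to `v`. -/
noncomputable def hyperplaneReflection {n : ℕ} (v y : Fin n → ℝ) : Fin n → ℝ :=
  y - (2 * ((∑ i, y i * v i) / (∑ i, v i * v i))) • v

section HyperplaneReflection

variable {n : ℕ}

theorem hyperplaneReflection_eq (v y : Fin n → ℝ) :
    hyperplaneReflection v y = y - (2 * (y ⬝ᵥ v / v ⬝ᵥ v)) • v := rfl

theorem isLinearMap_hyperplaneReflection (v : Fin n → ℝ) :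
    IsLinearMap ℝ (hyperplaneReflection v) where
  map_add x y := by
    simp only [hyperplaneReflection_eq, add_dotProduct]
    module
  map_smul c x := by
    simp only [hyperplaneReflection_eq, smul_dotProduct, smul_eq_mul]
    module

theorem hyperplaneReflection_dotProduct {v : Fin n → ℝ} (hv : v ⬝ᵥ v ≠ 0) (x y : Fin n → ℝ) :
    hyperplaneReflection v x ⬝ᵥ hyperplaneReflection v y = x ⬝ᵥ y := by
  simp only [hyperplaneReflection_eq, sub_dotProduct, dotProduct_sub, smul_dotProduct,
    dotProduct_smul, smul_eq_mul, dotProduct_comm v y]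
  field_simp
  ring

theorem hyperplaneReflection_involutive {v : Fin n → ℝ} (hv : v ⬝ᵥ v ≠ 0) :
    Function.Involutive (hyperplaneReflection v) := by
  intro y
  have h : hyperplaneReflection v y ⬝ᵥ v = -(y ⬝ᵥ v) := by
    simp only [hyperplaneReflection_eq, sub_dotProduct, smul_dotProduct, smul_eq_mul]
    field_simp
    ring
  rw [hyperplaneReflection_eq v (hyperplaneReflection v y), h, hyperplaneReflection_eq]
  module

theorem nrm_hyperplaneReflection {v : Fin n → ℝ} (hv : v ⬝ᵥ v ≠ 0) (y : Fin n → ℝ) :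
    nrm (hyperplaneReflection v y) = nrm y := by
  have h := hyperplaneReflection_dotProduct hv y y
  simp only [dotProduct, ← sq] at h
  rw [nrm, nrm, h]

theorem distS_hyperplaneReflection {v : Fin n → ℝ} (hv : v ⬝ᵥ v ≠ 0) {S : Set (Fin n → ℝ)}
    (hS : hyperplaneReflection v '' S = S) (y : Fin n → ℝ) :
    distS (hyperplaneReflection v y) S = distS y S := by
  have h : (fun s => nrm (hyperplaneReflection v y - s)) '' (hyperplaneReflection v '' S) =
      (fun s => nrm (y - s)) '' S := by
    rw [Set.image_image]
    refine Set.image_congr fun s _ => ?_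
    rw [← (isLinearMap_hyperplaneReflection v).map_sub, nrm_hyperplaneReflection hv]
  rw [hS] at h
  rw [distS, distS, h]

end HyperplaneReflection

theorem Function.Involutive.image_eq_of_mapsTo {α : Type*} {f : α → α} (hf : f.Involutive)
    {s : Set α} (h : Set.MapsTo f s s) : f '' s = s :=
  h.image_subset.antisymm fun x hx => ⟨f x, h hx, hf x⟩

section Swap

variable {n : ℕ} {G : Matrix (Fin n) (Fin n) ℝ} {j k : Fin n}

theorem dotProduct_sub_row_self (hjk : j ≠ k)
    (h : G *ᵥ (G j - G k) = Pi.single j 1 - Pi.single k 1) :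
    (G j - G k) ⬝ᵥ (G j - G k) = 2 := by
  have hj := congrFun h j
  have hk := congrFun h k
  simp only [mulVec, Pi.sub_apply, Pi.single_eq_same, Pi.single_eq_of_ne hjk,
    Pi.single_eq_of_ne hjk.symm] at hj hk
  rw [sub_dotProduct]
  linarith

/-- In coordinates with respect to the rows of `G`, the reflection exchanges the `j`-th and
`k`-th coordinates. -/
theorem hyperplaneReflection_vecMul (hjk : j ≠ k)
    (h : G *ᵥ (G j - G k) = Pi.single j 1 - Pi.single k 1) (z : Fin n → ℝ) :
    hyperplaneReflection (G j - G k) (z ᵥ* G) = (z ∘ Equiv.swap j k) ᵥ* G := by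
  have hz : z ∘ Equiv.swap j k = z - (z j - z k) • (Pi.single j 1 - Pi.single k 1) := by
    ext i
    by_cases hij : i = j
    · subst hij
      simp [hjk]
    by_cases hik : i = k
    · subst hik
      simp [hjk.symm]
    · simp [Equiv.swap_apply_of_ne_of_ne hij hik, hij, hik]
  rw [hyperplaneReflection_eq, dotProduct_sub_row_self hjk h, ← dotProduct_mulVec, h, hz,
    sub_vecMul, smul_vecMul, sub_vecMul, single_one_vecMul, single_one_vecMul,
    dotProduct_sub, dotProduct_single_one, dotProduct_single_one, mul_div_cancel₀ _ two_ne_zero]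
  rfl

theorem hyperplaneReflection_row (hjk : j ≠ k)
    (h : G *ᵥ (G j - G k) = Pi.single j 1 - Pi.single k 1) (i : Fin n) :
    hyperplaneReflection (G j - G k) (G i) = G (Equiv.swap j k i) := by
  have hi := hyperplaneReflection_vecMul hjk h (Pi.single i 1)
  have hs : (Pi.single i 1 : Fin n → ℝ) ∘ Equiv.swap j k = Pi.single (Equiv.swap j k i) 1 := by
    ext l
    simp [Pi.single_apply, Equiv.swap_apply_eq_iff]
  rw [hs, single_one_vecMul, single_one_vecMul] at hi
  exact hi

end Swap

theorem gramE_mulVec_sub_row {n : ℕ} {G : Matrix (Fin n) (Fin n) ℝ}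
    (hGram : G * G.transpose = gramE n) {j k : Fin n}
    (hjk : (3 ≤ (j : ℕ) ∧ j < k) ∨ ((j : ℕ) = 1 ∧ (k : ℕ) = 2)) :
    G *ᵥ (G j - G k) = Pi.single j 1 - Pi.single k 1 := by
  have hG : ∀ i l, G i ⬝ᵥ G l = gramE n i l := fun i l => congrFun (congrFun hGram i) l
  ext i
  simp only [mulVec, dotProduct_sub, hG, gramE, of_apply, Pi.sub_apply, Pi.single_apply,
    Fin.ext_iff, Fin.lt_def] at hjk ⊢
  split_ifs <;> first | omega | norm_num

/-- for the `Eₙ` basis (`6 ≤ n ≤ 8`) and a pair `(j,k)` with either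
`4 ≤ j < k ≤ n` or `(j,k) = (2,3)`, the reflection across the
bisector hyperplane of `g_j, g_k` is the unique linear map swapping `g_j` and `g_k` and
fixing the other basis vectors; it is orthogonal, preserves `Λ`, `P(B)` and the corner
sets `C^b`, and hence preserves the distances to `C^b`. -/
theorem En_folding_reflection (n : ℕ) [NeZero n] (hn6 : 6 ≤ n) (hn8 : n ≤ 8)
    (G : Matrix (Fin n) (Fin n) ℝ) (hG : IsUnit G.det)
    (hGram : G * G.transpose = gramE n)
    (j k : Fin n)
    (hjk : (3 ≤ (j : ℕ) ∧ j < k) ∨ ((j : ℕ) = 1 ∧ (k : ℕ) = 2)) :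
    let v : Fin n → ℝ := G j - G k
    let T : (Fin n → ℝ) → (Fin n → ℝ) :=
      fun y => y - (2 * ((∑ i, y i * v i) / (∑ i, v i * v i))) • v
    (T (G j) = G k ∧ T (G k) = G j ∧ ∀ i : Fin n, i ≠ j → i ≠ k → T (G i) = G i) ∧
    IsLinearMap ℝ T ∧
    (∀ y y' : Fin n → ℝ, ∑ i, T y i * T y' i = ∑ i, y i * y' i) ∧
    T '' {x | latticePt G x} = {x | latticePt G x} ∧
    T '' fundPar G = fundPar G ∧
    (∀ b : ℝ, b = 0 ∨ b = 1 → T '' cornerSet G b = cornerSet G b) ∧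
    (∀ y : Fin n → ℝ, ∀ b : ℝ, b = 0 ∨ b = 1 →
      distS (T y) (cornerSet G b) = distS y (cornerSet G b)) := by
  have hne : j ≠ k := by
    simp only [ne_eq, Fin.ext_iff, Fin.lt_def] at hjk ⊢
    omega
  have hj0 : (0 : Fin n) ≠ j := by
    simp only [ne_eq, Fin.ext_iff, Fin.val_zero, Fin.lt_def] at hjk ⊢
    omega
  have hk0 : (0 : Fin n) ≠ k := by
    simp only [ne_eq, Fin.ext_iff, Fin.val_zero, Fin.lt_def] at hjk ⊢
    omega
  have h := gramE_mulVec_sub_row hGram hjk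
  have hv : (G j - G k) ⬝ᵥ (G j - G k) ≠ 0 := by
    rw [dotProduct_sub_row_self hne h]
    exact two_ne_zero
  have hinv := hyperplaneReflection_involutive hv
  have hrow := hyperplaneReflection_row hne h
  have hcorner : ∀ b : ℝ,
      hyperplaneReflection (G j - G k) '' cornerSet G b = cornerSet G b := by
    refine fun b => hinv.image_eq_of_mapsTo ?_
    rintro _ ⟨z, hz, hz0, rfl⟩
    refine ⟨z ∘ Equiv.swap j k, fun i => hz _, ?_, hyperplaneReflection_vecMul hne h z⟩
    rw [Function.comp_apply, Equiv.swap_apply_of_ne_of_ne hj0 hk0, hz0]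
  refine ⟨⟨?_, ?_, fun i hij hik => ?_⟩, isLinearMap_hyperplaneReflection _,
    hyperplaneReflection_dotProduct hv, hinv.image_eq_of_mapsTo ?_, hinv.image_eq_of_mapsTo ?_,
    fun b _ => hcorner b, fun y b _ => distS_hyperplaneReflection hv (hcorner b) y⟩
  · exact (hrow j).trans (by rw [Equiv.swap_apply_left])
  · exact (hrow k).trans (by rw [Equiv.swap_apply_right])
  · exact (hrow i).trans (by rw [Equiv.swap_apply_of_ne_of_ne hij hik])
  · rintro _ ⟨z, rfl⟩
    exact ⟨z ∘ Equiv.swap j k, hyperplaneReflection_vecMul hne h _⟩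
  · rintro _ ⟨α, hα, rfl⟩
    exact ⟨α ∘ Equiv.swap j k, fun i => hα _, hyperplaneReflection_vecMul hne h α⟩
end

section
/- Let n ≥ 3 and let G be an invertible n×n real matrix whose rows g₁,…,gₙ have Gram matrix Γ_{Dₙ} (diagonal entries 2, entries (1,2),(2,1) equal to 0, all other off-diagonal entries 1). A corner x = Σᵢ zᵢgᵢ with z ∈ {0,1}ⁿ satisfies ⟨x, g_j − g_k⟩ ≥ 0 for all 3 ≤ j < k ≤ n if and only if z₃ ≥ z₄ ≥ … ≥ zₙ; equivalently, if and only if x has one of the forms x₁ = g₃ + … + gᵢ, x₁ + g₁, x₂ = g₃ + … + gᵢ + g₂, or x₂ + g₁ (where the chain g₃ + … + gᵢ, with 3 ≤ i ≤ n, may also be empty). These are the only corners of P(B) lying on the non-negative side of every bisector hyperplane BH(g_j, g_k) = {y : ⟨y, g_j − g_k⟩ = 0}, 3 ≤ j < k ≤ n. -/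
open Matrix Finset

/-- The `Dₙ` Gram matrix: diagonal entries `2`, entries `(1,2)` and `(2,1)` equal to `0`
(in 1-based indexing), all other off-diagonal entries `1`. -/
def gramD (n : ℕ) : Matrix (Fin n) (Fin n) ℝ :=
  Matrix.of fun i j =>
    if i = j then 2
    else if ((i : ℕ) = 0 ∧ (j : ℕ) = 1) ∨ ((i : ℕ) = 1 ∧ (j : ℕ) = 0) then 0 else 1

/-- Away from the first two indices, the columns of `gramD n` differ as those of the identity. -/
theorem gramD_sub_gramD {n : ℕ} (s j k : Fin n) (hj : 2 ≤ (j : ℕ)) (hk : 2 ≤ (k : ℕ)) :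
    gramD n s j - gramD n s k = (if s = j then 1 else 0) - (if s = k then 1 else 0) := by
  have h : ∀ l : Fin n, 2 ≤ (l : ℕ) → gramD n s l = 1 + if s = l then 1 else 0 := by
    intro l hl
    have hl' : ¬(((s : ℕ) = 0 ∧ (l : ℕ) = 1) ∨ ((s : ℕ) = 1 ∧ (l : ℕ) = 0)) := by omega
    simp only [gramD, Matrix.of_apply, if_neg hl']
    split_ifs <;> norm_num
  rw [h j hj, h k hk]
  ring

/-- The pairing of `z ᵥ* G` with `g_j - g_k` is `z j - z k`. -/
theorem sum_vecMul_mul_sub_of_gramD {n : ℕ} {G : Matrix (Fin n) (Fin n) ℝ}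
    (hGram : G * G.transpose = gramD n) (z : Fin n → ℝ) (j k : Fin n)
    (hj : 2 ≤ (j : ℕ)) (hk : 2 ≤ (k : ℕ)) :
    ∑ t, (z ᵥ* G) t * (G j t - G k t) = z j - z k := by
  have h : ∀ l, ∑ t, (z ᵥ* G) t * G l t = ∑ s, z s * gramD n s l := by
    intro l
    have := congrFun (Matrix.vecMul_vecMul z G G.transpose) l
    rw [hGram] at this
    exact this
  simp only [mul_sub, Finset.sum_sub_distrib]
  rw [h, h, ← Finset.sum_sub_distrib]
  simp only [← mul_sub, gramD_sub_gramD _ j k hj hk]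
  simp [mul_sub]

/-- A `{0,1}`-vector is antitone from index `2` on iff its ones there form an initial segment. -/
theorem antitone_from_two_iff_exists_initial_segment {n : ℕ} (hn : 2 ≤ n) {z : Fin n → ℝ}
    (hz : ∀ i, z i = 0 ∨ z i = 1) :
    (∀ j k : Fin n, 2 ≤ (j : ℕ) → j ≤ k → z k ≤ z j) ↔
      ∃ i : ℕ, 2 ≤ i ∧ i ≤ n ∧ ∀ j : Fin n, 2 ≤ (j : ℕ) → (z j = 1 ↔ (j : ℕ) < i) := by
  classical
  constructor
  · intro h
    by_cases hex : ∃ i : ℕ, 2 ≤ i ∧ ∃ hi : i < n, z ⟨i, hi⟩ = 0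
    · obtain ⟨h2, hi, h0⟩ := Nat.find_spec hex
      refine ⟨Nat.find hex, h2, hi.le, fun j hj => ⟨fun h1 => ?_, fun hlt => ?_⟩⟩
      · by_contra! hle
        have := h ⟨Nat.find hex, hi⟩ j h2 hle
        linarith
      · exact (hz j).resolve_left fun hj0 => Nat.find_min hex hlt ⟨hj, j.isLt, hj0⟩
    · refine ⟨n, hn, le_rfl, fun j hj => ⟨fun _ => j.isLt, fun _ => ?_⟩⟩
      exact (hz j).resolve_left fun hj0 => hex ⟨j, hj, j.isLt, hj0⟩
  · rintro ⟨i, -, -, hi⟩ j k hj hjk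
    have hjk' : (j : ℕ) ≤ k := hjk
    rcases hz k with hk | hk
    · rcases hz j with h | h <;> rw [hk, h]
      norm_num
    · rw [hk, (hi j hj).2 (hjk'.trans_lt ((hi k (hj.trans hjk')).1 hk))]

/-- for the `Dₙ` basis, a corner `x = Σ zᵢgᵢ` with `z ∈ {0,1}ⁿ` is on the
non-negative side of every bisector hyperplane `BH(g_j,g_k)`, `3 ≤ j < k ≤ n`, iff
`z₃ ≥ z₄ ≥ … ≥ zₙ`; equivalently iff `x` is of the form `g₃+…+gᵢ`, `g₃+…+gᵢ+g₁`,
`g₃+…+gᵢ+g₂` or `g₃+…+gᵢ+g₂+g₁` (chain possibly empty).  (Indices here are 0-based: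
`g_j` of the paper is row `j−1` of `G`.) -/
theorem Dn_corners_on_nonneg_side (n : ℕ) (hn : 3 ≤ n)
    (G : Matrix (Fin n) (Fin n) ℝ) (hG : IsUnit G.det)
    (hGram : G * G.transpose = gramD n)
    (z : Fin n → ℝ) (hz : ∀ i, z i = 0 ∨ z i = 1) :
    ((∀ j k : Fin n, 2 ≤ (j : ℕ) → j < k →
        0 ≤ ∑ t, (z ᵥ* G) t * (G j t - G k t))
      ↔ (∀ j k : Fin n, 2 ≤ (j : ℕ) → j ≤ k → z k ≤ z j)) ∧
    ((∀ j k : Fin n, 2 ≤ (j : ℕ) → j < k →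
        0 ≤ ∑ t, (z ᵥ* G) t * (G j t - G k t))
      ↔ (∃ i : ℕ, 2 ≤ i ∧ i ≤ n ∧
          ∀ j : Fin n, 2 ≤ (j : ℕ) → (z j = 1 ↔ (j : ℕ) < i))) := by
  have key : (∀ j k : Fin n, 2 ≤ (j : ℕ) → j < k →
        0 ≤ ∑ t, (z ᵥ* G) t * (G j t - G k t))
      ↔ (∀ j k : Fin n, 2 ≤ (j : ℕ) → j ≤ k → z k ≤ z j) := by
    have hpair : ∀ j k : Fin n, 2 ≤ (j : ℕ) → j < k →
        ∑ t, (z ᵥ* G) t * (G j t - G k t) = z j - z k := fun j k hj hjk =>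
      sum_vecMul_mul_sub_of_gramD hGram z j k hj (hj.trans (Fin.lt_def.1 hjk).le)
    constructor
    · intro h j k hj hjk
      rcases hjk.eq_or_lt with rfl | hlt
      · exact le_rfl
      · have := h j k hj hlt
        rw [hpair j k hj hlt] at this
        exact sub_nonneg.1 this
    · intro h j k hj hjk
      rw [hpair j k hj hjk]
      exact sub_nonneg.2 (h j k hj hjk.le)
  exact ⟨key, key.trans (antitone_from_two_iff_exists_initial_segment (by omega) hz)⟩
end

section
/- Let 6 ≤ n ≤ 8 and let G be an invertible n×n real matrix whose rows g₁,…,gₙ have Gram matrix Γ_{Eₙ} (diagonal entries 2, entries (1,2),(2,1),(1,3),(3,1) equal to 0, all other off-diagonal entries 1). A corner x = Σᵢ zᵢgᵢ with z ∈ {0,1}ⁿ satisfies ⟨x, g₂ − g₃⟩ ≥ 0 and ⟨x, g_j − g_k⟩ ≥ 0 for all 4 ≤ j < k ≤ n if and only if z₂ ≥ z₃ and z₄ ≥ z₅ ≥ … ≥ zₙ; equivalently, if and only if x has one of the forms x₁ = g₄ + … + gᵢ, x₂ = g₄ + … + gᵢ + g₂, x₃ = g₄ + … + gᵢ + g₂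 + g₃, or any of these plus g₁ (where the chain g₄ + … + gᵢ, 4 ≤ i ≤ n, may be empty). These are the only corners of P(B) on the non-negative side of all the reflection hyperplanes BH(g_j,g_k), 4 ≤ j < k ≤ n, and BH(g₂,g₃). -/
open Matrix Finset

/-- The pairing of `zG` with `g_j - g_k` is computed from the Gram matrix of the rows of `G`. -/
lemma sum_vecMul_mul_sub_eq {m n R : Type*} [Fintype m] [Fintype n] [CommRing R]
    (G : Matrix m n R) (z : m → R) (j k : m) :
    ∑ t, (z ᵥ* G) t * (G j t - G k t) =
      ∑ i, z i * ((G * Gᵀ) i j - (G * Gᵀ) i k) := by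
  have h : ∀ l, ∑ t, (z ᵥ* G) t * G l t = ∑ i, z i * (G * Gᵀ) i l := fun l => by
    change (z ᵥ* G) ⬝ᵥ (fun t => Gᵀ t l) = (z ᵥ* (G * Gᵀ)) l
    rw [← vecMul_vecMul]
    rfl
  simp only [mul_sub, Finset.sum_sub_distrib, h]

lemma sum_mul_sub_eq_of_col_sub_eq {m R : Type*} [Fintype m] [DecidableEq m] [CommRing R]
    (A : Matrix m m R) (z : m → R) (j k : m)
    (h : ∀ i, A i j - A i k = (if i = j then 1 else 0) - (if i = k then 1 else 0)) :
    ∑ i, z i * (A i j - A i k) = z j - z k := by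
  simp [h, mul_sub]

lemma gramE_col_one_sub_col_two {n : ℕ} (h₁ : 1 < n) (h₂ : 2 < n) (i : Fin n) :
    gramE n i ⟨1, h₁⟩ - gramE n i ⟨2, h₂⟩ =
      (if i = ⟨1, h₁⟩ then 1 else 0) - (if i = ⟨2, h₂⟩ then 1 else 0) := by
  simp only [gramE, Matrix.of_apply, Fin.ext_iff]
  split_ifs <;> first | omega | norm_num at * <;> omega

lemma gramE_col_sub_col {n : ℕ} {j k : Fin n} (hj : 3 ≤ (j : ℕ)) (hk : 3 ≤ (k : ℕ)) (i : Fin n) :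
    gramE n i j - gramE n i k = (if i = j then 1 else 0) - (if i = k then 1 else 0) := by
  simp only [gramE, Matrix.of_apply, Fin.ext_iff]
  split_ifs <;> first | omega | norm_num

/-- A `{0,1}`-valued sequence on the indices `a, …, n - 1` is antitone iff it is the indicator
of an initial segment. -/
lemma antitone_from_iff_exists_threshold {n a : ℕ} (ha : a ≤ n) (z : Fin n → ℝ)
    (hz : ∀ i, z i = 0 ∨ z i = 1) :
    (∀ j k : Fin n, a ≤ (j : ℕ) → j ≤ k → z k ≤ z j) ↔
      ∃ i : ℕ, a ≤ i ∧ i ≤ n ∧ ∀ j : Fin n, a ≤ (j : ℕ) → (z j = 1 ↔ (j : ℕ) < i) := by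
  classical
  constructor
  · intro h
    have hex : ∃ m, a ≤ m ∧ ∀ hm : m < n, z ⟨m, hm⟩ ≠ 1 :=
      ⟨n, ha, fun hm => absurd hm (lt_irrefl n)⟩
    obtain ⟨hai, hi⟩ := Nat.find_spec hex
    refine ⟨Nat.find hex, hai,
      Nat.find_min' hex ⟨ha, fun hm => absurd hm (lt_irrefl n)⟩, fun j hj => ⟨fun h1 => ?_, ?_⟩⟩
    · by_contra! hle
      have hlt := hle.trans_lt j.isLt
      have h0 := (hz ⟨_, hlt⟩).resolve_right (hi hlt)
      have := h ⟨_, hlt⟩ j hai hle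
      linarith
    · intro hlt
      by_contra hne
      exact Nat.find_min hex hlt ⟨hj, fun _ => hne⟩
  · rintro ⟨i, -, -, hi⟩ j k hj hjk
    rcases hz k with hk | hk
    · rcases hz j with h | h <;> simp [h, hk]
    · have hki := (hi k (hj.trans hjk)).1 hk
      rw [hk, (hi j hj).2 (lt_of_le_of_lt hjk hki)]

/-- for the `Eₙ` basis (`6 ≤ n ≤ 8`), a corner `x = Σ zᵢgᵢ`, `z ∈ {0,1}ⁿ`,
is on the non-negative side of `BH(g₂,g₃)` and of all `BH(g_j,g_k)`, `4 ≤ j < k ≤ n`, iff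
`z₂ ≥ z₃` and `z₄ ≥ z₅ ≥ … ≥ zₙ`; equivalently iff `x` is one of the forms
`g₄+…+gᵢ`, `g₄+…+gᵢ+g₂`, `g₄+…+gᵢ+g₂+g₃`, or any of these plus `g₁` (chain possibly
empty).  (Indices here are 0-based: `g_j` of the paper is row `j−1` of `G`.) -/
theorem En_corners_on_nonneg_side (n : ℕ) (hn6 : 6 ≤ n) (hn8 : n ≤ 8)
    (G : Matrix (Fin n) (Fin n) ℝ) (hG : IsUnit G.det)
    (hGram : G * G.transpose = gramE n)
    (z : Fin n → ℝ) (hz : ∀ i, z i = 0 ∨ z i = 1) :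
    ((0 ≤ ∑ t, (z ᵥ* G) t * (G ⟨1, by omega⟩ t - G ⟨2, by omega⟩ t) ∧
      ∀ j k : Fin n, 3 ≤ (j : ℕ) → j < k →
        0 ≤ ∑ t, (z ᵥ* G) t * (G j t - G k t))
      ↔ (z ⟨2, by omega⟩ ≤ z ⟨1, by omega⟩ ∧
          ∀ j k : Fin n, 3 ≤ (j : ℕ) → j ≤ k → z k ≤ z j)) ∧
    ((0 ≤ ∑ t, (z ᵥ* G) t * (G ⟨1, by omega⟩ t - G ⟨2, by omega⟩ t) ∧
      ∀ j k : Fin n, 3 ≤ (j : ℕ) → j < k →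
        0 ≤ ∑ t, (z ᵥ* G) t * (G j t - G k t))
      ↔ (z ⟨2, by omega⟩ ≤ z ⟨1, by omega⟩ ∧
          ∃ i : ℕ, 3 ≤ i ∧ i ≤ n ∧
            ∀ j : Fin n, 3 ≤ (j : ℕ) → (z j = 1 ↔ (j : ℕ) < i))) := by
  have key : (0 ≤ ∑ t, (z ᵥ* G) t * (G ⟨1, by omega⟩ t - G ⟨2, by omega⟩ t) ∧
      ∀ j k : Fin n, 3 ≤ (j : ℕ) → j < k →
        0 ≤ ∑ t, (z ᵥ* G) t * (G j t - G k t))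
      ↔ (z ⟨2, by omega⟩ ≤ z ⟨1, by omega⟩ ∧
          ∀ j k : Fin n, 3 ≤ (j : ℕ) → j ≤ k → z k ≤ z j) := by
    have hpair : ∀ j k : Fin n, 3 ≤ (j : ℕ) → j < k →
        ∑ t, (z ᵥ* G) t * (G j t - G k t) = z j - z k := fun j k hj hjk => by
      rw [sum_vecMul_mul_sub_eq, hGram]
      exact sum_mul_sub_eq_of_col_sub_eq _ z j k (gramE_col_sub_col hj (hj.trans hjk.le))
    rw [sum_vecMul_mul_sub_eq, hGram,
      sum_mul_sub_eq_of_col_sub_eq _ z _ _ (gramE_col_one_sub_col_two _ _), sub_nonneg]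
    refine and_congr_right fun _ => ⟨fun h j k hj hjk => ?_, fun h j k hj hjk => ?_⟩
    · rcases hjk.eq_or_lt with rfl | hlt
      · exact le_rfl
      · have := h j k hj hlt
        rwa [hpair j k hj hlt, sub_nonneg] at this
    · rw [hpair j k hj hjk, sub_nonneg]
      exact h j k hj hjk.le
  refine ⟨key, key.trans (and_congr_right fun _ => ?_)⟩
  exact antitone_from_iff_exists_threshold (by omega) z hz
end
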